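/- arXiv:1811.01281 — 6 statements merged into one kernel-verified Lean document; each statement's English description precedes it below -/
import Mathlib

section
/- For all integers d and k with 2 ≤ k ≤ d, the graph on Π_d^k is connected: any two partitions in Π_d^k are joined by a finite chain of partitions in Π_d^k in which consecutive terms are adjacent (equivalently, the reflexive-transitive closure of the adjacency relation relates any two elements of Π_d^k). -/
/-- A (labelled) partition of the lattice `ℤ × ℤ` of degree `d` and length `k`:
an (unordered, here labelled) collection `Λ 1, …, Λ k` of finite-index additive
subgroups of `ℤ × ℤ` which collectively span `ℤ × ℤ`, whose indices add up to `d`. -/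
def IsLatticePartition (d k : ℕ) (Λ : Fin k → AddSubgroup (ℤ × ℤ)) : Prop :=
  (∀ i, (Λ i).index ≠ 0) ∧ (⨆ i, Λ i) = ⊤ ∧ (∑ i, (Λ i).index) = d

/-- Two partitions `(Λ_1,…,Λ_k)`, `(Λ'_1,…,Λ'_k)` are adjacent if there exist indices
`i < j` and `i' < j'` with `Λ_i + Λ_j = Λ'_{i'} + Λ'_{j'}` and
`[ℤ²:Λ_i] + [ℤ²:Λ_j] = [ℤ²:Λ'_{i'}] + [ℤ²:Λ'_{j'}]`. -/
def AdjacentPartitions {k : ℕ} (Λ Λ' : Fin k → AddSubgroup (ℤ × ℤ)) : Prop :=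
  ∃ i j i' j' : Fin k, i < j ∧ i' < j' ∧
    Λ i ⊔ Λ j = Λ' i' ⊔ Λ' j' ∧
    (Λ i).index + (Λ j).index = (Λ' i').index + (Λ' j').index

namespace LatticePartition

theorem exists_le_index_eq_mul (M : AddSubgroup (ℤ × ℤ)) (hM : M.index ≠ 0) (n : ℕ) :
    ∃ N ≤ M, N.index = n * M.index := by
  have hne : Nontrivial M := by
    rw [AddSubgroup.nontrivial_iff_ne_bot]
    rintro rfl
    rw [AddSubgroup.index_bot] at hM
    exact hM Nat.card_eq_zero_of_infinite
  let S : Submodule ℤ (ℤ × ℤ) := M.toIntSubmodule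
  have hS : Nontrivial S := hne
  let b := Module.Free.chooseBasis ℤ S
  obtain ⟨i⟩ : Nonempty (Module.Free.ChooseBasisIndex ℤ S) := b.index_nonempty
  let f : M →+ ℤ := (b.coord i).toAddMonoidHom
  have hf : Function.Surjective f := fun z => ⟨z • b i, by
    change b.coord i (z • b i) = z
    simp⟩
  refine ⟨((AddSubgroup.zmultiples (n : ℤ)).comap f).map M.subtype,
    AddSubgroup.map_subtype_le _, ?_⟩
  rw [AddSubgroup.index_map_subtype, AddSubgroup.index_comap_of_surjective _ hf,
    Int.index_zmultiples, Int.natAbs_natCast]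

theorem adjacentPartitions_of_ne {k : ℕ} {Λ Λ' : Fin k → AddSubgroup (ℤ × ℤ)}
    {i j i' j' : Fin k} (hij : i ≠ j) (hij' : i' ≠ j')
    (hsup : Λ i ⊔ Λ j = Λ' i' ⊔ Λ' j')
    (hindex : (Λ i).index + (Λ j).index = (Λ' i').index + (Λ' j').index) :
    AdjacentPartitions Λ Λ' := by
  rcases hij.lt_or_gt with h | h <;> rcases hij'.lt_or_gt with h' | h'
  · exact ⟨i, j, i', j', h, h', hsup, hindex⟩
  · exact ⟨i, j, j', i', h, h', by rw [hsup, sup_comm], by omega⟩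
  · exact ⟨j, i, i', j', h, h', by rw [← hsup, sup_comm], by omega⟩
  · exact ⟨j, i, j', i', h, h', by rw [sup_comm, hsup, sup_comm], by omega⟩

/-- Edges of the graph of partitions of degree `d` and length `k`. -/
abbrev Edge (d k : ℕ) (a b : Fin k → AddSubgroup (ℤ × ℤ)) : Prop :=
  IsLatticePartition d k a ∧ IsLatticePartition d k b ∧ AdjacentPartitions a b

theorem Edge.symm {d k : ℕ} {a b : Fin k → AddSubgroup (ℤ × ℤ)} (h : Edge d k a b) :
    Edge d k b a := by
  obtain ⟨ha, hb, i, j, i', j', hij, hij', hsup, hindex⟩ := h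
  exact ⟨hb, ha, i', j', i, j, hij', hij, hsup.symm, hindex.symm⟩

theorem isLatticePartition_update_pair {d k : ℕ} {Λ : Fin k → AddSubgroup (ℤ × ℤ)}
    (hΛ : IsLatticePartition d k Λ) {i j : Fin k} (hij : i ≠ j) {M N : AddSubgroup (ℤ × ℤ)}
    (hM : M.index ≠ 0) (hN : N.index ≠ 0) (hsup : Λ i ⊔ Λ j ≤ M ⊔ N)
    (hindex : M.index + N.index = (Λ i).index + (Λ j).index) :
    IsLatticePartition d k (Function.update (Function.update Λ i M) j N) := by
  obtain ⟨h0, htop, hsum⟩ := hΛ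
  set Λ' := Function.update (Function.update Λ i M) j N with hΛ'
  have hi : Λ' i = M := by simp [hΛ', hij]
  have hj : Λ' j = N := by simp [hΛ']
  have hl : ∀ l, l ≠ i → l ≠ j → Λ' l = Λ l := fun l h h' => by simp [hΛ', h, h']
  refine ⟨fun l => ?_, ?_, ?_⟩
  · by_cases hlj : l = j
    · rwa [hlj, hj]
    · by_cases hli : l = i
      · rwa [hli, hi]
      · rw [hl l hli hlj]
        exact h0 l
  · have hMN : M ⊔ N ≤ ⨆ l, Λ' l := by
      rw [← hi, ← hj]
      exact sup_le (le_iSup Λ' i) (le_iSup Λ' j)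
    rw [eq_top_iff, ← htop]
    refine iSup_le fun l => ?_
    by_cases hlj : l = j
    · exact hlj ▸ (le_sup_right.trans hsup).trans hMN
    · by_cases hli : l = i
      · exact hli ▸ (le_sup_left.trans hsup).trans hMN
      · exact hl l hli hlj ▸ le_iSup Λ' l
  · have split : ∀ f : Fin k → ℕ,
        ∑ l, f l = f i + f j + ∑ l ∈ (Finset.univ.erase i).erase j, f l := fun f => by
      rw [← Finset.add_sum_erase _ f (Finset.mem_univ i),
        ← Finset.add_sum_erase _ f (Finset.mem_erase.2 ⟨hij.symm, Finset.mem_univ j⟩), add_assoc]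
    rw [← hsum, split, split fun l => (Λ l).index, hi, hj, hindex]
    congr 1
    refine Finset.sum_congr rfl fun l hl' => ?_
    simp only [Finset.mem_erase] at hl'
    rw [hl l hl'.2.1 hl'.1]

theorem exists_reflTransGen_eq_top {d k : ℕ} (n : ℕ)
    (Λ : Fin k → AddSubgroup (ℤ × ℤ)) (hΛ : IsLatticePartition d k Λ) (i : Fin k)
    (hn : (Λ i).index ≤ n) :
    ∃ Λ', Relation.ReflTransGen (Edge d k) Λ Λ' ∧ IsLatticePartition d k Λ' ∧ ∃ j, Λ' j = ⊤ := by
  induction n generalizing Λ with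
  | zero => exact absurd (Nat.le_zero.1 hn) (hΛ.1 i)
  | succ n ih =>
    by_cases htop : Λ i = ⊤
    · exact ⟨Λ, .refl, hΛ, i, htop⟩
    obtain ⟨j, hj⟩ : ∃ j, ¬ Λ j ≤ Λ i := by
      by_contra! h
      exact htop (eq_top_iff.2 (hΛ.2.1 ▸ iSup_le h))
    have hij : i ≠ j := by
      rintro rfl
      exact hj le_rfl
    set M := Λ i ⊔ Λ j with hMdef
    have hiM : Λ i < M := left_lt_sup.2 hj
    obtain ⟨a, ha⟩ := AddSubgroup.index_dvd_of_le hiM.le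
    obtain ⟨b, hb⟩ := AddSubgroup.index_dvd_of_le (le_sup_right : Λ j ≤ M)
    have hi0 := hΛ.1 i
    have hj0 := hΛ.1 j
    have hM : M.index ≠ 0 := fun h => hi0 (by rw [ha, h, zero_mul])
    have ha0 : a ≠ 0 := fun h => hi0 (by rw [ha, h, mul_zero])
    have hb0 : b ≠ 0 := fun h => hj0 (by rw [hb, h, mul_zero])
    have : (Λ i).FiniteIndex := ⟨hi0⟩
    have hlt : M.index < (Λ i).index := AddSubgroup.index_strictAnti hiM
    obtain ⟨N, hNM, hN⟩ := exists_le_index_eq_mul M hM (a + b - 1)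
    have hN0 : N.index ≠ 0 := by
      rw [hN]
      exact mul_ne_zero (by omega) hM
    have hsum : M.index + N.index = (Λ i).index + (Λ j).index := by
      obtain ⟨c, hc⟩ : ∃ c, a + b = c + 1 := ⟨a + b - 1, by omega⟩
      rw [hN, ha, hb, hc, ← mul_add, hc, Nat.add_sub_cancel]
      ring
    have hup := isLatticePartition_update_pair hΛ hij hM hN0 le_sup_left hsum
    have hi' : Function.update (Function.update Λ i M) j N i = M := by simp [hij]
    have hj' : Function.update (Function.update Λ i M) j N j = N := by simp
    obtain ⟨Λ', hpath, h⟩ := ih _ hup (by rw [hi']; omega)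
    refine ⟨Λ', .head ⟨hΛ, hup, adjacentPartitions_of_ne hij hij ?_ ?_⟩ hpath, h⟩
    · rw [hi', hj', sup_eq_left.2 hNM]
    · rw [hi', hj', hsum]

/-- The subgroup `aℤ × ℤ`. -/
def vertical (a : ℕ) : AddSubgroup (ℤ × ℤ) :=
  (AddSubgroup.zmultiples (a : ℤ)).comap (AddMonoidHom.fst ℤ ℤ)

/-- The subgroup `ℤ × aℤ`. -/
def horizontal (a : ℕ) : AddSubgroup (ℤ × ℤ) :=
  (AddSubgroup.zmultiples (a : ℤ)).comap (AddMonoidHom.snd ℤ ℤ)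

theorem index_vertical (a : ℕ) : (vertical a).index = a := by
  rw [vertical, AddSubgroup.index_comap_of_surjective _ Prod.fst_surjective,
    Int.index_zmultiples, Int.natAbs_natCast]

theorem index_horizontal (a : ℕ) : (horizontal a).index = a := by
  rw [horizontal, AddSubgroup.index_comap_of_surjective _ Prod.snd_surjective,
    Int.index_zmultiples, Int.natAbs_natCast]

theorem vertical_sup_horizontal (a b : ℕ) : vertical a ⊔ horizontal b = ⊤ := by
  refine eq_top_iff.2 fun x _ => ?_
  rw [show x = (0, x.2) + (x.1, 0) by simp]
  refine AddSubgroup.add_mem_sup ?_ ?_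
  · exact zero_mem (AddSubgroup.zmultiples (a : ℤ))
  · exact zero_mem (AddSubgroup.zmultiples (b : ℤ))

/-- The partition `(ℤ × ℤ, aℤ × ℤ, ℤ × cℤ, ℤ × ℤ, …, ℤ × ℤ)`. -/
def standard (n a c : ℕ) : Fin (n + 3) → AddSubgroup (ℤ × ℤ) :=
  Fin.cons ⊤ (Fin.cons (vertical a) (Fin.cons (horizontal c) fun _ => ⊤))

theorem isLatticePartition_standard {d n a c : ℕ} (ha : a ≠ 0) (hc : c ≠ 0)
    (hd : a + c + (n + 1) = d) : IsLatticePartition d (n + 3) (standard n a c) := by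
  refine ⟨fun i => ?_, eq_top_iff.2 (le_iSup (standard n a c) 0), ?_⟩
  · refine Fin.cases ?_ (Fin.cases ?_ (Fin.cases ?_ fun i => ?_)) i <;>
      simp only [standard, Fin.cons_zero, Fin.cons_succ, index_vertical, index_horizontal,
        AddSubgroup.index_top, ne_eq, one_ne_zero, not_false_eq_true, ha, hc]
  · simp only [standard, Fin.sum_univ_succ, Fin.cons_zero, Fin.cons_succ, index_vertical,
      index_horizontal, AddSubgroup.index_top, Finset.sum_const, Finset.card_univ,
      Fintype.card_fin, smul_eq_mul]
    omega

theorem reflTransGen_standard {d n : ℕ} {Λ : Fin (n + 3) → AddSubgroup (ℤ × ℤ)}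
    (hΛ : IsLatticePartition d (n + 3) Λ) {i : Fin (n + 3)} (hi : Λ i = ⊤) :
    Relation.ReflTransGen (Edge d (n + 3)) Λ (standard n 1 (d - (n + 2))) := by
  obtain ⟨j, hij⟩ : ∃ j, j ≠ i := exists_ne i
  set a := (Λ j).index with ha
  have ha0 : a ≠ 0 := hΛ.1 j
  have hle : a + (n + 2) ≤ d := by
    rw [← hΛ.2.2, ← Finset.add_sum_erase _ _ (Finset.mem_univ j), ← ha]
    refine Nat.add_le_add_left ?_ a
    have h := Finset.card_nsmul_le_sum (Finset.univ.erase j) (fun l => (Λ l).index) 1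
      fun l _ => Nat.one_le_iff_ne_zero.2 (hΛ.1 l)
    simpa [Finset.card_erase_of_mem] using h
  have hB : IsLatticePartition d (n + 3) (standard n a (d - (n + 1) - a)) :=
    isLatticePartition_standard ha0 (by omega) (by omega)
  have hC : IsLatticePartition d (n + 3) (standard n 1 (d - (n + 2))) :=
    isLatticePartition_standard one_ne_zero (by omega) (by omega)
  have h1 : ∀ a c, standard n a c 1 = vertical a := fun _ _ => rfl
  have h2 : ∀ a c, standard n a c 2 = horizontal c := fun _ _ => rfl
  have h0 : ∀ a c, standard n a c 0 = ⊤ := fun _ _ => rfl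
  refine .head ⟨hΛ, hB, ?_⟩ (.single ⟨hB, hC, ?_⟩)
  · refine adjacentPartitions_of_ne (i := i) (j := j) (i' := 0) (j' := 1) hij.symm
      Fin.zero_ne_one ?_ ?_
    · rw [hi, h0, top_sup_eq, top_sup_eq]
    · rw [hi, h0, h1, index_vertical]
  · have h12 : (1 : Fin (n + 3)) ≠ 2 :=
      fun h => absurd (@Fin.succ_injective (n + 2) 0 1 h) Fin.zero_ne_one
    refine adjacentPartitions_of_ne (i := 1) (j := 2) (i' := 1) (j' := 2) h12 h12 ?_ ?_
    · simp only [h1, h2, vertical_sup_horizontal]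
    · simp only [h1, h2, index_vertical, index_horizontal]
      omega

end LatticePartition

open LatticePartition in
/-- For all integers `d` and `k` with `2 ≤ k ≤ d`, the graph on `Π_d^k` is connected: any
two partitions in `Π_d^k` are joined by a finite chain of partitions in `Π_d^k` in which
consecutive terms are adjacent. -/
theorem lattice_partition_graph_connected (d k : ℕ) (h2 : 2 ≤ k) (hkd : k ≤ d)
    (Λ Λ' : Fin k → AddSubgroup (ℤ × ℤ))
    (hΛ : IsLatticePartition d k Λ) (hΛ' : IsLatticePartition d k Λ') :
    Relation.ReflTransGen
      (fun a b => IsLatticePartition d k a ∧ IsLatticePartition d k b ∧ AdjacentPartitions a b)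
      Λ Λ' := by
  change Relation.ReflTransGen (Edge d k) Λ Λ'
  have : Std.Symm (Edge d k) := ⟨fun _ _ => Edge.symm⟩
  obtain rfl | ⟨n, rfl⟩ : k = 2 ∨ ∃ n, k = n + 3 := by
    rcases h2.eq_or_lt with h | h
    · exact .inl h.symm
    · exact .inr ⟨k - 3, by omega⟩
  · have hsup : ∀ A, IsLatticePartition d 2 A →
        A 0 ⊔ A 1 = ⊤ ∧ (A 0).index + (A 1).index = d := fun A hA =>
      ⟨eq_top_iff.2 (hA.2.1 ▸ iSup_le (Fin.forall_fin_two.2 ⟨le_sup_left, le_sup_right⟩)),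
        (Fin.sum_univ_two _).symm.trans hA.2.2⟩
    refine .single ⟨hΛ, hΛ', 0, 1, 0, 1, Fin.zero_lt_one, Fin.zero_lt_one, ?_, ?_⟩
    · rw [(hsup Λ hΛ).1, (hsup Λ' hΛ').1]
    · rw [(hsup Λ hΛ).2, (hsup Λ' hΛ').2]
  · obtain ⟨A, hA, hA', i, hi⟩ := exists_reflTransGen_eq_top _ Λ hΛ 0 le_rfl
    obtain ⟨B, hB, hB', j, hj⟩ := exists_reflTransGen_eq_top _ Λ' hΛ' 0 le_rfl
    exact (hA.trans (reflTransGen_standard hA' hi)).trans <|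
      Relation.ReflTransGen.stdSymm.symm _ _
        (hB.trans (reflTransGen_standard hB' hj))
end

section
/- For all integers d and k with 2 ≤ k ≤ d, every partition ϖ ∈ Π_d^k is joined, by a finite chain of partitions in Π_d^k in which consecutive terms are adjacent, to a partition in Π_d^k having ℤ² itself among its summands. -/
/-- A finite-index subgroup of `ℤ × ℤ` contains subgroups of every relative index. -/
theorem exists_le_index_eq_mul {L : AddSubgroup (ℤ × ℤ)} (hL : L.index ≠ 0) (t : ℕ) :
    ∃ M ≤ L, M.index = t * L.index := by
  obtain ⟨e, he⟩ := Int.subgroup_cyclic (L.map (AddMonoidHom.fst ℤ ℤ))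
  rw [← AddSubgroup.zmultiples_eq_closure] at he
  have hdvd := AddSubgroup.index_map_dvd L (f := AddMonoidHom.fst ℤ ℤ) Prod.fst_surjective
  have he0 : e.natAbs ≠ 0 := by
    rw [he, Int.index_zmultiples] at hdvd
    exact ne_zero_of_dvd_ne_zero hL hdvd
  have hle : AddSubgroup.zmultiples ((t : ℤ) * e) ≤ AddSubgroup.zmultiples e := by
    rw [AddSubgroup.zmultiples_le]
    exact AddSubgroup.mem_zmultiples_iff.mpr ⟨t, by simp⟩
  have hrel : (AddSubgroup.zmultiples ((t : ℤ) * e)).relIndex (AddSubgroup.zmultiples e) = t := by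
    have h := AddSubgroup.relIndex_mul_index hle
    rw [Int.index_zmultiples, Int.index_zmultiples, Int.natAbs_mul, Int.natAbs_natCast] at h
    exact Nat.eq_of_mul_eq_mul_right (Nat.pos_of_ne_zero he0) h
  refine ⟨(AddSubgroup.zmultiples ((t : ℤ) * e)).comap (AddMonoidHom.fst ℤ ℤ) ⊓ L,
    inf_le_right, ?_⟩
  rw [← AddSubgroup.relIndex_mul_index inf_le_right, AddSubgroup.inf_relIndex_right,
    AddSubgroup.relIndex_comap, he, hrel]

/-- Two summands of a lattice partition may be replaced by their sum and a suitable subgroup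
of it, yielding an adjacent partition. -/
theorem IsLatticePartition.exists_adjacent_merge {d k : ℕ} {Λ : Fin k → AddSubgroup (ℤ × ℤ)}
    (hΛ : IsLatticePartition d k Λ) {i j : Fin k} (hij : i < j) :
    ∃ Λ' : Fin k → AddSubgroup (ℤ × ℤ), IsLatticePartition d k Λ' ∧ AdjacentPartitions Λ Λ' ∧
      Λ' i = Λ i ⊔ Λ j ∧ ∀ l, l ≠ i → l ≠ j → Λ' l = Λ l := by
  obtain ⟨hfin, hsup, hsum⟩ := hΛ
  obtain ⟨a, ha⟩ := AddSubgroup.index_dvd_of_le (le_sup_left : Λ i ≤ Λ i ⊔ Λ j)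
  obtain ⟨b, hb⟩ := AddSubgroup.index_dvd_of_le (le_sup_right : Λ j ≤ Λ i ⊔ Λ j)
  have hi := hfin i
  have hj := hfin j
  rw [ha, mul_ne_zero_iff] at hi
  rw [hb, mul_ne_zero_iff] at hj
  obtain ⟨c, rfl⟩ := Nat.exists_eq_succ_of_ne_zero hi.2
  obtain ⟨M, hM, hMidx⟩ := exists_le_index_eq_mul hi.1 (c + b)
  have hpair : (Λ i).index + (Λ j).index = (Λ i ⊔ Λ j).index + M.index := by
    rw [ha, hb, hMidx, Nat.succ_eq_add_one]
    ring
  set Λ' := Function.update (Function.update Λ i (Λ i ⊔ Λ j)) j M with hΛ'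
  have hΛ'i : Λ' i = Λ i ⊔ Λ j := by simp [hΛ', hij.ne]
  have hΛ'j : Λ' j = M := by simp [hΛ']
  have hΛ'l : ∀ l, l ≠ i → l ≠ j → Λ' l = Λ l := fun l h₁ h₂ => by simp [hΛ', h₁, h₂]
  refine ⟨Λ', ⟨fun l => ?_, ?_, ?_⟩, ⟨i, j, i, j, hij, hij, ?_, ?_⟩, hΛ'i, hΛ'l⟩
  · by_cases hlj : l = j
    · subst hlj
      rw [hΛ'j, hMidx]
      exact mul_ne_zero (by have := hj.2; omega) hi.1
    · by_cases hli : l = i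
      · subst hli
        rw [hΛ'i]
        exact hi.1
      · rw [hΛ'l l hli hlj]
        exact hfin l
  · rw [eq_top_iff, ← hsup]
    have hle : Λ i ⊔ Λ j ≤ ⨆ l, Λ' l := hΛ'i ▸ le_iSup Λ' i
    refine iSup_le fun l => ?_
    by_cases hli : l = i
    · exact hli ▸ le_sup_left.trans hle
    · by_cases hlj : l = j
      · exact hlj ▸ le_sup_right.trans hle
      · exact hΛ'l l hli hlj ▸ le_iSup Λ' l
  · have hjmem : j ∈ Finset.univ.erase i := by simp [hij.ne']
    rw [← hsum, ← Finset.add_sum_erase _ _ (Finset.mem_univ i), ← Finset.add_sum_erase _ _ hjmem,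
      ← Finset.add_sum_erase _ (fun l => (Λ l).index) (Finset.mem_univ i),
      ← Finset.add_sum_erase _ (fun l => (Λ l).index) hjmem, ← add_assoc, ← add_assoc,
      hpair, hΛ'i, hΛ'j]
    congr 1
    refine Finset.sum_congr rfl fun l hl => ?_
    simp only [Finset.mem_erase] at hl
    rw [hΛ'l l hl.2.1 hl.1]
  · rw [hΛ'i, hΛ'j, sup_eq_left.mpr hM]
  · rw [hΛ'i, hΛ'j, hpair]

/-- A summand of a lattice partition may be enlarged, through a chain of adjacent
partitions, by any collection of later summands. -/
theorem IsLatticePartition.exists_chain_sup {d k : ℕ} {Λ : Fin k → AddSubgroup (ℤ × ℤ)}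
    (hΛ : IsLatticePartition d k Λ) (i : Fin k) (s : Finset (Fin k)) (hs : ∀ j ∈ s, i < j) :
    ∃ Λ' : Fin k → AddSubgroup (ℤ × ℤ),
      Relation.ReflTransGen
        (fun a b => IsLatticePartition d k a ∧ IsLatticePartition d k b ∧ AdjacentPartitions a b)
        Λ Λ' ∧
      IsLatticePartition d k Λ' ∧ Λ' i = Λ i ⊔ s.sup Λ ∧ ∀ l ∉ s, l ≠ i → Λ' l = Λ l := by
  induction s using Finset.induction_on with
  | empty => exact ⟨Λ, .refl, hΛ, by simp, fun _ _ _ => rfl⟩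
  | insert j s hj ih =>
    have hij := hs j (Finset.mem_insert_self j s)
    obtain ⟨Λ₁, hchain, hΛ₁, hi, hl⟩ := ih fun l h => hs l (Finset.mem_insert_of_mem h)
    obtain ⟨Λ₂, hΛ₂, hadj, hi', hl'⟩ := hΛ₁.exists_adjacent_merge hij
    refine ⟨Λ₂, hchain.tail ⟨hΛ₁, hΛ₂, hadj⟩, hΛ₂, ?_, fun l hls hli => ?_⟩
    · rw [hi', hi, hl j hj hij.ne', Finset.sup_insert, sup_assoc, sup_comm (s.sup Λ)]
    · rw [Finset.mem_insert, not_or] at hls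
      rw [hl' l hli hls.1, hl l hls.2 hli]

/-- For all integers `d` and `k` with `2 ≤ k ≤ d`, every partition `ϖ ∈ Π_d^k` is joined, by a
finite chain of partitions in `Π_d^k` in which consecutive terms are adjacent, to a partition
in `Π_d^k` having `ℤ²` itself among its summands. -/
theorem lattice_partition_connected_to_top (d k : ℕ) (h2 : 2 ≤ k) (hkd : k ≤ d)
    (Λ : Fin k → AddSubgroup (ℤ × ℤ)) (hΛ : IsLatticePartition d k Λ) :
    ∃ Λ' : Fin k → AddSubgroup (ℤ × ℤ),
      Relation.ReflTransGen
        (fun a b => IsLatticePartition d k a ∧ IsLatticePartition d k b ∧ AdjacentPartitions a b)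
        Λ Λ' ∧
      IsLatticePartition d k Λ' ∧ ∃ i, Λ' i = ⊤ := by
  let i : Fin k := ⟨0, by omega⟩
  obtain ⟨Λ', hchain, hΛ', hi, -⟩ := hΛ.exists_chain_sup i (Finset.univ.erase i) fun j hj =>
    Fin.lt_def.mpr (Nat.pos_of_ne_zero fun h => Finset.ne_of_mem_erase hj (Fin.ext h))
  refine ⟨Λ', hchain, hΛ', i, ?_⟩
  rw [hi, ← Finset.sup_insert, Finset.insert_erase (Finset.mem_univ i), Finset.sup_univ_eq_iSup,
    hΛ.2.1]
end

section
/- Let L be a finitely generated free ℤ-module, φ : L × L → ℤ a ℤ-bilinear alternating form (i.e., φ(x,x) = 0 for all x ∈ L), and L' ⊆ L a submodule of finite index n = [L:L']. Then for all x, y ∈ L, the element n·φ(x,y) lies in the additive subgroup of ℤ generated by {φ(u,v) : u, v ∈ L'}. -/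
/-- Let `L` be a finitely generated free `ℤ`-module, `φ : L × L → ℤ` a `ℤ`-bilinear
alternating form, and `L' ⊆ L` a subgroup of finite index `n = [L:L']`. Then for all
`x, y ∈ L`, the element `n·φ(x,y)` lies in the additive subgroup of `ℤ` generated by
`{φ(u,v) : u, v ∈ L'}`. -/
theorem index_smul_mem_span_of_alternating (L : Type*) [AddCommGroup L] [Module ℤ L]
    [Module.Free ℤ L] [Module.Finite ℤ L]
    (φ : L →ₗ[ℤ] L →ₗ[ℤ] ℤ) (halt : ∀ x, φ x x = 0)
    (L' : AddSubgroup L) (hfin : L'.index ≠ 0) (x y : L) :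
    (L'.index : ℤ) * φ x y ∈
      AddSubgroup.closure {z : ℤ | ∃ u ∈ L', ∃ v ∈ L', φ u v = z} := by
  set q := QuotientAddGroup.mk' L' with hq
  set H := AddSubgroup.zmultiples (q y)
  have hcard : L'.index = H.index * Nat.card H := by
    rw [H.index_mul_card, AddSubgroup.index]
  have hy : Nat.card H • y ∈ L' := by
    rw [← QuotientAddGroup.eq_zero_iff, ← QuotientAddGroup.mk'_apply, map_nsmul,
      Nat.card_zmultiples]
    exact addOrderOf_nsmul_eq_zero (q y)
  obtain ⟨k, hk⟩ := AddSubgroup.mem_zmultiples_iff.mp (H.nsmul_index_mem (q x))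
  have hx : H.index • x - k • y ∈ L' := by
    rw [← QuotientAddGroup.eq_zero_iff, ← QuotientAddGroup.mk'_apply, map_sub, map_nsmul,
      map_zsmul, ← hq, hk, sub_self]
  refine AddSubgroup.subset_closure ⟨_, hx, _, hy, ?_⟩
  rw [map_nsmul, map_sub, map_nsmul, map_zsmul, LinearMap.sub_apply, hcard]
  simp [halt]
  ring
end

section
/- Let L be a finitely generated free ℤ-module, φ : L × L → ℤ a ℤ-bilinear alternating form (i.e., φ(x,x) = 0 for all x ∈ L), and L' ⊆ L a submodule of finite index. If [L:L']·⟨φ(L×L)⟩ = ⟨φ(L'×L')⟩, then for every intermediate submodule L'' with L' ⊆ L'' ⊆ L one also has [L:L'']·⟨φ(L×L)⟩ = ⟨φ(L''×L'')⟩. -/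
/-- For a natural number `n` and a subgroup `G ⊆ ℤ`, the subgroup `n·G = {n·g : g ∈ G}`. -/
def natSmulSubgroup (n : ℕ) (G : AddSubgroup ℤ) : AddSubgroup ℤ :=
  G.map (AddMonoidHom.mulLeft (n : ℤ))

theorem AddSubgroup.relIndex_nsmul_mem {G : Type*} [AddCommGroup G] {H K : AddSubgroup G}
    {x : G} (hx : x ∈ K) : H.relIndex K • x ∈ H := by
  have h := (H.addSubgroupOf K).nsmul_index_mem (⟨x, hx⟩ : K)
  simpa [AddSubgroup.mem_addSubgroupOf, AddSubgroup.relIndex] using h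

/-- The values of an alternating form on a subgroup `N`, multiplied by the index of `M` in `N`,
are generated by the values on `M`. -/
theorem relIndex_mul_mem_closure_of_alternating {L : Type*} [AddCommGroup L] [Module ℤ L]
    (φ : L →ₗ[ℤ] L →ₗ[ℤ] ℤ) (halt : ∀ x, φ x x = 0) {M N : AddSubgroup L} (hMN : M ≤ N)
    {u v : L} (hu : u ∈ N) (hv : v ∈ N) :
    (M.relIndex N : ℤ) * φ u v ∈
      AddSubgroup.closure {z : ℤ | ∃ x ∈ M, ∃ y ∈ M, φ x y = z} := by
  set P := M ⊔ AddSubgroup.zmultiples u with hP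
  set Q := P ⊔ AddSubgroup.zmultiples v with hQ
  have hMP : M ≤ P := le_sup_left
  have hPQ : P ≤ Q := le_sup_left
  have hPN : P ≤ N := sup_le hMN (by simpa using hu)
  have hQN : Q ≤ N := sup_le hPN (by simpa using hv)
  have huP : u ∈ P := le_sup_right (a := M) (AddSubgroup.mem_zmultiples u)
  have hvQ : v ∈ Q := le_sup_right (a := P) (AddSubgroup.mem_zmultiples v)
  have ha : M.relIndex P • u ∈ M := AddSubgroup.relIndex_nsmul_mem huP
  have hb : P.relIndex Q • v ∈ P := AddSubgroup.relIndex_nsmul_mem hvQ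
  obtain ⟨m, hm, w, hw, hmw⟩ := AddSubgroup.mem_sup.1 hb
  obtain ⟨k, rfl⟩ := AddSubgroup.mem_zmultiples_iff.1 hw
  have hval : φ (M.relIndex P • u) m = (M.relIndex P : ℤ) * (P.relIndex Q * φ u v) := by
    rw [eq_sub_of_add_eq hmw]
    simp [halt]
  have hidx : M.relIndex P * P.relIndex Q * Q.relIndex N = M.relIndex N := by
    rw [AddSubgroup.relIndex_mul_relIndex _ _ _ hMP hPQ,
      AddSubgroup.relIndex_mul_relIndex _ _ _ (hMP.trans hPQ) hQN]
  have hmem := AddSubgroup.nsmul_mem _ (AddSubgroup.subset_closure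
    (show φ (M.relIndex P • u) m ∈ {z : ℤ | ∃ x ∈ M, ∃ y ∈ M, φ x y = z} from
      ⟨_, ha, _, hm, rfl⟩)) (Q.relIndex N)
  convert hmem using 1
  rw [hval, ← hidx, nsmul_eq_mul]
  push_cast
  ring

/-- Let `L` be a finitely generated free `ℤ`-module, `φ : L × L → ℤ` a `ℤ`-bilinear
alternating form, and `L' ⊆ L` a subgroup of finite index. If
`[L:L']·⟨φ(L×L)⟩ = ⟨φ(L'×L')⟩`, then for every intermediate subgroup `L''` with
`L' ⊆ L'' ⊆ L` one also has `[L:L'']·⟨φ(L×L)⟩ = ⟨φ(L''×L'')⟩`. -/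
theorem index_smul_span_eq_of_eq (L : Type*) [AddCommGroup L] [Module ℤ L]
    [Module.Free ℤ L] [Module.Finite ℤ L]
    (φ : L →ₗ[ℤ] L →ₗ[ℤ] ℤ) (halt : ∀ x, φ x x = 0)
    (L' : AddSubgroup L) (hfin : L'.index ≠ 0)
    (hEq : natSmulSubgroup L'.index (AddSubgroup.closure {z : ℤ | ∃ u v, φ u v = z})
      = AddSubgroup.closure {z : ℤ | ∃ u ∈ L', ∃ v ∈ L', φ u v = z})
    (L'' : AddSubgroup L) (hle : L' ≤ L'') :
    natSmulSubgroup L''.index (AddSubgroup.closure {z : ℤ | ∃ u v, φ u v = z})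
      = AddSubgroup.closure {z : ℤ | ∃ u ∈ L'', ∃ v ∈ L'', φ u v = z} := by
  apply le_antisymm
  · rw [natSmulSubgroup, AddSubgroup.map_le_iff_le_comap, AddSubgroup.closure_le]
    rintro _ ⟨u, v, rfl⟩
    have h := relIndex_mul_mem_closure_of_alternating φ halt (le_top (a := L''))
      (AddSubgroup.mem_top u) (AddSubgroup.mem_top v)
    rw [AddSubgroup.relIndex_top_right] at h
    exact h
  · rw [AddSubgroup.closure_le]
    rintro _ ⟨u, hu, v, hv, rfl⟩
    have h := relIndex_mul_mem_closure_of_alternating φ halt hle hu hv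
    rw [← hEq] at h
    obtain ⟨g, hg, hgv⟩ := AddSubgroup.mem_map.1 h
    have hidx := AddSubgroup.relIndex_mul_index hle
    have hr : (L'.relIndex L'' : ℤ) ≠ 0 := by
      exact_mod_cast left_ne_zero_of_mul (hidx.trans_ne hfin)
    refine AddSubgroup.mem_map.2 ⟨g, hg, mul_left_cancel₀ hr ?_⟩
    rw [← hgv, ← hidx]
    simp [mul_assoc]
end

section
/- Let d be a positive integer, let L = ℤ⁴, and let α : L × L → ℤ be the alternating bilinear form α((x₁,x₂,x₃,x₄),(y₁,y₂,y₃,y₄)) = x₁y₃ − x₃y₁ + d(x₂y₄ − x₄y₂) (the standard form of type (1,d)). Let Λ' ⊆ L be a subgroup of finite index k = [L:Λ']. Then the following are equivalent: (1) α(u,v) ∈ kℤ for all u, v ∈ Λ'; (2) k divides d, and every x ∈ L satisfying α(x,y) ∈ dℤ for all y ∈ L lies in Λ'. -/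
open Matrix in
/-- A linear combination of the rows of `B` lies in every subgroup containing these rows. -/
theorem AddSubgroup.vecMul_mem {ι κ : Type*} [Fintype κ] (H : AddSubgroup (ι → ℤ))
    {B : Matrix κ ι ℤ} (hB : ∀ i, B i ∈ H) (c : κ → ℤ) : c ᵥ* B ∈ H := by
  rw [vecMul_eq_sum]
  exact H.sum_mem fun i _ => H.zsmul_mem (hB i) (c i)

open Matrix in
/-- A finite-index subgroup of `ℤⁿ` is the row lattice of a square integer matrix whose
determinant is, up to sign, the index. -/
theorem AddSubgroup.exists_matrix_natAbs_det_eq_index {ι : Type*} [Fintype ι] [DecidableEq ι]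
    (H : AddSubgroup (ι → ℤ)) (hH : H.index ≠ 0) :
    ∃ B : Matrix ι ι ℤ, (∀ i, B i ∈ H) ∧ B.det.natAbs = H.index ∧
      ∀ x ∈ H, ∃ c : ι → ℤ, x = c ᵥ* B := by
  obtain ⟨e⟩ := Int.addSubgroup_index_ne_zero_iff.mp hH
  let b : Module.Basis ι ℤ H := .ofEquivFun e.toIntLinearEquiv
  refine ⟨.of fun i => (b i : ι → ℤ), fun i => (b i).2, ?_, fun x hx => ⟨b.repr ⟨x, hx⟩, ?_⟩⟩
  · rw [H.index_eq_natAbs_det (Pi.basisFun ℤ ι) b, Pi.basisFun_det_apply]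
  · rw [vecMul_eq_sum]
    have h := congrArg H.subtype (b.sum_repr ⟨x, hx⟩)
    simp only [map_sum, map_zsmul] at h
    exact h.symm

open Matrix in
/-- The index of a finite-index subgroup of `ℤⁿ` divides the determinant of any matrix whose rows
lie in the subgroup. -/
theorem AddSubgroup.index_dvd_det {ι : Type*} [Fintype ι] [DecidableEq ι]
    (H : AddSubgroup (ι → ℤ)) (hH : H.index ≠ 0) (M : Matrix ι ι ℤ) (hM : ∀ i, M i ∈ H) :
    (H.index : ℤ) ∣ M.det := by
  obtain ⟨B, -, hdet, hspan⟩ := H.exists_matrix_natAbs_det_eq_index hH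
  choose C hC using fun i => hspan (M i) (hM i)
  have hCB : M = of C * B := funext hC
  rw [hCB, det_mul, ← hdet, Int.natAbs_dvd]
  exact dvd_mul_left _ _

open Matrix in
/-- By Cramer's rule, `x` is an integer combination of the rows of `B` as soon as `det B` divides
every determinant obtained by replacing a row of `B` by `x`. -/
theorem Matrix.exists_vecMul_eq_of_det_dvd_det_updateRow {ι : Type*} [Fintype ι] [DecidableEq ι]
    {B : Matrix ι ι ℤ} (hB : B.det ≠ 0) {x : ι → ℤ}
    (hx : ∀ i, B.det ∣ (B.updateRow i x).det) : ∃ c : ι → ℤ, x = c ᵥ* B := by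
  choose c hc using hx
  have hcramer : cramer Bᵀ x = B.det • c := by
    ext i
    simp [cramer_transpose_apply, hc]
  refine ⟨c, smul_right_injective _ hB ?_⟩
  have h := mulVec_cramer Bᵀ x
  rw [hcramer, mulVec_smul, det_transpose, mulVec_transpose] at h
  exact h.symm

/-- The Pfaffian of the Gram matrix of four vectors for the standard alternating form of type
`(1,d)` is `-d` times their determinant. -/
theorem type_one_d_pfaffian (d : ℤ) (α : (Fin 4 → ℤ) → (Fin 4 → ℤ) → ℤ)
    (hα : ∀ x y, α x y = x 0 * y 2 - x 2 * y 0 + d * (x 1 * y 3 - x 3 * y 1))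
    (M : Matrix (Fin 4) (Fin 4) ℤ) :
    d * M.det = α (M 0) (M 2) * α (M 1) (M 3) - α (M 0) (M 1) * α (M 2) (M 3)
      - α (M 0) (M 3) * α (M 1) (M 2) := by
  simp only [hα, Matrix.det_succ_row_zero, Fin.sum_univ_succ]
  simp [Fin.succAbove]
  ring


/-- Let `d` be a positive integer, `L = ℤ⁴`, and let `α : L × L → ℤ` be the standard
alternating bilinear form of type `(1,d)`:
`α(x,y) = x₁y₃ − x₃y₁ + d(x₂y₄ − x₄y₂)`. Let `Λ' ⊆ L` be a subgroup of finite index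
`k = [L:Λ']`. Then the following are equivalent:
(1) `α(u,v) ∈ kℤ` for all `u, v ∈ Λ'`;
(2) `k` divides `d`, and every `x ∈ L` satisfying `α(x,y) ∈ dℤ` for all `y ∈ L` lies in `Λ'`. -/
theorem type_one_d_lattice_equivalence (d : ℕ) (hd : 0 < d)
    (α : (Fin 4 → ℤ) → (Fin 4 → ℤ) → ℤ)
    (hα : ∀ x y, α x y = x 0 * y 2 - x 2 * y 0 + (d : ℤ) * (x 1 * y 3 - x 3 * y 1))
    (Λ' : AddSubgroup (Fin 4 → ℤ)) (hfin : Λ'.index ≠ 0) :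
    (∀ u ∈ Λ', ∀ v ∈ Λ', (Λ'.index : ℤ) ∣ α u v) ↔
      (Λ'.index ∣ d ∧ ∀ x : Fin 4 → ℤ, (∀ y : Fin 4 → ℤ, (d : ℤ) ∣ α x y) → x ∈ Λ') := by
  constructor
  · intro h
    obtain ⟨B, hBmem, hdet, -⟩ := Λ'.exists_matrix_natAbs_det_eq_index hfin
    have hk : (Λ'.index : ℤ) ≠ 0 := mod_cast hfin
    have hd' : (d : ℤ) ≠ 0 := mod_cast hd.ne'
    have hB (i j) : (Λ'.index : ℤ) ∣ α (B i) (B j) := h _ (hBmem i) _ (hBmem j)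
    constructor
    · have hpf : (Λ'.index : ℤ) * Λ'.index ∣ d * B.det := by
        rw [type_one_d_pfaffian d α hα B]
        exact dvd_sub (dvd_sub (mul_dvd_mul (hB ..) (hB ..)) (mul_dvd_mul (hB ..) (hB ..)))
          (mul_dvd_mul (hB ..) (hB ..))
      rw [← Int.dvd_natAbs, Int.natAbs_mul, hdet, Nat.cast_mul, Int.natAbs_natCast] at hpf
      exact mod_cast Int.dvd_of_mul_dvd_mul_right hk hpf
    · intro x hx
      have hx' (y) : (d : ℤ) ∣ α y x := by
        have hneg : α y x = -α x y := by rw [hα, hα]; ring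
        exact hneg ▸ (hx y).neg_right
      have hupdate (i) : B.det ∣ (B.updateRow i x).det := by
        rw [← Int.natAbs_dvd, hdet]
        refine Int.dvd_of_mul_dvd_mul_left hd' ?_
        rw [type_one_d_pfaffian d α hα]
        have hl (u i j) : (d * Λ'.index : ℤ) ∣ α x u * α (B i) (B j) :=
          mul_dvd_mul (hx u) (hB i j)
        have hl' (u i j) : (d * Λ'.index : ℤ) ∣ α u x * α (B i) (B j) :=
          mul_dvd_mul (hx' u) (hB i j)
        have hr (u i j) : (d * Λ'.index : ℤ) ∣ α (B i) (B j) * α x u :=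
          mul_comm (α x u) _ ▸ hl u i j
        have hr' (u i j) : (d * Λ'.index : ℤ) ∣ α (B i) (B j) * α u x :=
          mul_comm (α u x) _ ▸ hl' u i j
        refine dvd_sub (dvd_sub ?_ ?_) ?_ <;> fin_cases i <;>
          simp [hl, hl', hr, hr']
      have hdet0 : B.det ≠ 0 := Int.natAbs_ne_zero.mp (hdet ▸ hfin)
      obtain ⟨c, rfl⟩ := Matrix.exists_vecMul_eq_of_det_dvd_det_updateRow hdet0 hupdate
      exact Λ'.vecMul_mem hBmem c
  · rintro ⟨hkd, hK⟩ u hu v hv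
    have h1 : ![0, 1, 0, 0] ∈ Λ' := hK _ fun y => by simp [hα]
    have h3 : ![0, 0, 0, 1] ∈ Λ' := hK _ fun y => by simp [hα]
    have hdvd := Λ'.index_dvd_det hfin (.of ![u, ![0, 1, 0, 0], v, ![0, 0, 0, 1]])
      (by intro i; fin_cases i <;> simpa)
    have hdet : (Matrix.of ![u, ![0, 1, 0, 0], v, ![0, 0, 0, 1]]).det
        = u 0 * v 2 - u 2 * v 0 := by
      simp [Matrix.det_succ_row_zero, Fin.sum_univ_succ, Fin.succAbove]
      ring
    rw [hα, ← hdet]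
    exact dvd_add hdvd ((Int.natCast_dvd_natCast.mpr hkd).mul_right _)
end

section
/- For every positive integer n, the number of additive subgroups of ℤ × ℤ of index exactly n is σ(n) = Σ_{h ∣ n} h, the sum of the positive divisors of n. -/
namespace AddSubgroup

/-- The index of a subgroup of a product is the index of its projection to the first factor times
the index of its fibre over zero. -/
theorem index_map_fst_mul_index_comap_inr {A B : Type*} [AddCommGroup A] [AddCommGroup B]
    (S : AddSubgroup (A × B)) :
    (S.map (AddMonoidHom.fst A B)).index * (S.comap (AddMonoidHom.inr A B)).index = S.index := by
  have hker : (AddMonoidHom.inr A B).range = (AddMonoidHom.fst A B).ker := by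
    ext ⟨x, y⟩
    simp [-AddMonoidHom.ker_fst, AddMonoidHom.mem_ker, AddMonoidHom.mem_range,
      eq_comm (a := (0 : A))]
  have hrange : (AddMonoidHom.fst A B).range = ⊤ :=
    AddMonoidHom.range_eq_top.mpr Prod.fst_surjective
  rw [index_map, index_comap, hker, hrange, index_top, mul_one, mul_comm,
    ← relIndex_sup_left, relIndex_mul_index le_sup_left]

/-- Every subgroup of `ℤ` consists of the multiples of its index. -/
theorem mem_int_iff_index_dvd (H : AddSubgroup ℤ) (x : ℤ) : x ∈ H ↔ (H.index : ℤ) ∣ x := by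
  obtain ⟨a, rfl⟩ := Int.subgroup_cyclic H
  rw [← zmultiples_eq_closure, Int.index_zmultiples, Int.mem_zmultiples_iff, Int.natAbs_dvd]

end AddSubgroup

/-- The subgroup of `ℤ × ℤ` generated by `(a, b)` and `(0, d)`. -/
def hermiteLattice (a d b : ℤ) : AddSubgroup (ℤ × ℤ) where
  carrier := {p | ∃ k, p.1 = a * k ∧ d ∣ p.2 - b * k}
  zero_mem' := ⟨0, by simp⟩
  add_mem' := by
    rintro p q ⟨k, hk, hk'⟩ ⟨l, hl, hl'⟩
    refine ⟨k + l, by simp [hk, hl, mul_add], ?_⟩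
    have h : p.2 + q.2 - b * (k + l) = p.2 - b * k + (q.2 - b * l) := by ring
    exact h ▸ dvd_add hk' hl'
  neg_mem' := by
    rintro p ⟨k, hk, hk'⟩
    refine ⟨-k, by simp [hk], ?_⟩
    have h : -p.2 - b * -k = -(p.2 - b * k) := by ring
    exact h ▸ dvd_neg.mpr hk'

theorem mem_hermiteLattice {a d b : ℤ} {p : ℤ × ℤ} :
    p ∈ hermiteLattice a d b ↔ ∃ k, p.1 = a * k ∧ d ∣ p.2 - b * k :=
  Iff.rfl

theorem map_fst_hermiteLattice (a d b : ℤ) :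
    (hermiteLattice a d b).map (AddMonoidHom.fst ℤ ℤ) = AddSubgroup.zmultiples a := by
  ext x
  rw [AddSubgroup.mem_map, Int.mem_zmultiples_iff]
  constructor
  · rintro ⟨p, ⟨k, hk, -⟩, rfl⟩
    exact ⟨k, hk⟩
  · rintro ⟨k, rfl⟩
    exact ⟨(a * k, b * k), ⟨k, rfl, by simp⟩, rfl⟩

theorem comap_inr_hermiteLattice {a : ℤ} (ha : a ≠ 0) (d b : ℤ) :
    (hermiteLattice a d b).comap (AddMonoidHom.inr ℤ ℤ) = AddSubgroup.zmultiples d := by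
  ext y
  simp [mem_hermiteLattice, Int.mem_zmultiples_iff, ha]

theorem index_hermiteLattice {a : ℤ} (ha : a ≠ 0) (d b : ℤ) :
    (hermiteLattice a d b).index = a.natAbs * d.natAbs := by
  rw [← AddSubgroup.index_map_fst_mul_index_comap_inr, map_fst_hermiteLattice,
    comap_inr_hermiteLattice ha, Int.index_zmultiples, Int.index_zmultiples]

theorem hermiteLattice_params_eq {a a' : ℤ} (ha : a ≠ 0) (ha' : a' ≠ 0) {d d' : ℕ}
    {b : Fin d} {b' : Fin d'}
    (h : hermiteLattice a d (b : ℕ) = hermiteLattice a' d' (b' : ℕ)) (haa : d = d' → a = a') :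
    d = d' ∧ (b : ℕ) = b' := by
  have hd : d = d' := by
    simpa [comap_inr_hermiteLattice, ha, ha', Int.index_zmultiples] using
      congrArg (fun S => (S.comap (AddMonoidHom.inr ℤ ℤ)).index) h
  obtain rfl := haa hd
  subst hd
  refine ⟨rfl, ?_⟩
  have hmem : (a, ((b : ℕ) : ℤ)) ∈ hermiteLattice a d (b' : ℕ) :=
    h ▸ mem_hermiteLattice.mpr ⟨1, by simp⟩
  obtain ⟨k, hk, hk'⟩ := mem_hermiteLattice.mp hmem
  obtain rfl : k = 1 := by simpa [ha] using hk.symm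
  have hmod : (b' : ℕ) ≡ b [MOD d] :=
    Nat.modEq_iff_dvd.mpr (by simpa using hk')
  exact (hmod.eq_of_lt_of_lt b'.isLt b.isLt).symm

/-- Every finite-index subgroup of `ℤ × ℤ` has a Hermite normal form. -/
theorem exists_eq_hermiteLattice (S : AddSubgroup (ℤ × ℤ)) (hS : S.index ≠ 0) :
    ∃ a d : ℕ, a * d = S.index ∧ ∃ b : Fin d, S = hermiteLattice a d (b : ℕ) := by
  have hmul := S.index_map_fst_mul_index_comap_inr
  have ha := AddSubgroup.mem_int_iff_index_dvd (S.map (AddMonoidHom.fst ℤ ℤ))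
  have hd := AddSubgroup.mem_int_iff_index_dvd (S.comap (AddMonoidHom.inr ℤ ℤ))
  generalize (S.map (AddMonoidHom.fst ℤ ℤ)).index = a at *
  generalize (S.comap (AddMonoidHom.inr ℤ ℤ)).index = d at *
  simp only [AddSubgroup.mem_comap, AddMonoidHom.inr_apply] at hd
  have hd0 : 0 < d := Nat.pos_of_ne_zero (by rintro rfl; simp_all)
  obtain ⟨⟨a', c⟩, hc, rfl : a' = a⟩ := (ha a).mpr dvd_rfl
  have hb0 := Int.emod_nonneg c (Int.natCast_ne_zero.mpr hd0.ne')
  have hbd := Int.emod_lt_of_pos c (Int.natCast_pos.mpr hd0)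
  refine ⟨a, d, hmul, ⟨(c % d).toNat, by omega⟩, ?_⟩
  have hb : ((a : ℤ), c % d) ∈ S := by
    have := S.sub_mem hc ((hd (d * (c / d))).mpr (dvd_mul_right _ _))
    simpa [Int.emod_def] using this
  have hshift (k y : ℤ) : ((a : ℤ) * k, y) ∈ S ↔ (d : ℤ) ∣ y - c % d * k := by
    rw [← hd, ← S.add_mem_cancel_right (y := (0, _)) (S.zsmul_mem hb k)]
    simp [mul_comm]
  ext ⟨x, y⟩
  simp only [mem_hermiteLattice, Int.toNat_of_nonneg hb0]
  constructor
  · intro hxy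
    obtain ⟨k, rfl⟩ := (ha x).mp ⟨_, hxy, rfl⟩
    exact ⟨k, rfl, (hshift k y).mp hxy⟩
  · rintro ⟨k, rfl, hk⟩
    exact (hshift k y).mpr hk

/-- For every positive integer `n`, the number of additive subgroups of `ℤ × ℤ` of index
exactly `n` is `σ(n) = Σ_{h ∣ n} h`, the sum of the positive divisors of `n`. -/
theorem card_sublattices_of_index (n : ℕ) (hn : 0 < n) :
    Nat.card {Λ : AddSubgroup (ℤ × ℤ) // Λ.index = n} = ∑ h ∈ n.divisors, h := by
  have hpos (d : n.divisors) : ((n / d : ℕ) : ℤ) ≠ 0 :=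
    Int.natCast_ne_zero.mpr (Nat.div_pos (Nat.divisor_le d.2) (Nat.pos_of_mem_divisors d.2)).ne'
  let f (p : Σ d : n.divisors, Fin d) : {Λ : AddSubgroup (ℤ × ℤ) // Λ.index = n} :=
    ⟨hermiteLattice (n / p.1 : ℕ) (p.1 : ℕ) (p.2 : ℕ), by
      rw [index_hermiteLattice (hpos p.1), Int.natAbs_natCast, Int.natAbs_natCast,
        Nat.div_mul_cancel (Nat.dvd_of_mem_divisors p.1.2)]⟩
  have hf : Function.Bijective f := by
    constructor
    · rintro ⟨⟨d, hd⟩, b⟩ ⟨⟨d', hd'⟩, b'⟩ h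
      obtain ⟨rfl, hb⟩ := hermiteLattice_params_eq (hpos ⟨d, hd⟩) (hpos ⟨d', hd'⟩)
        (congrArg Subtype.val h) (by rintro rfl; rfl)
      obtain rfl := Fin.ext hb
      rfl
    · rintro ⟨S, rfl⟩
      obtain ⟨a, d, had, b, hb⟩ := exists_eq_hermiteLattice S hn.ne'
      refine ⟨⟨⟨d, Nat.mem_divisors.mpr ⟨⟨a, by rw [← had, mul_comm]⟩, hn.ne'⟩⟩, b⟩, ?_⟩
      have hdiv : S.index / d = a := by rw [← had, Nat.mul_div_cancel _ b.pos]
      exact Subtype.ext (by simp only [f, hdiv]; exact hb.symm)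
  rw [← Nat.card_congr (Equiv.ofBijective f hf), Nat.card_sigma]
  simp only [Nat.card_fin]
  exact Finset.sum_coe_sort n.divisors fun d => d
end
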